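/- arXiv:math/0701604 — 2 statements merged into one kernel-verified Lean document; each statement's English description precedes it below -/
import Mathlib

section
/- Holomorphy of the Hopf functions: if X is minimal (H_σ ≡ 0 for all σ) and the orthonormal normal section is torsion-free (T_{σ,i}^ω ≡ 0 for all σ,ω,i), then every Hopf function 𝓗_σ := L_{σ,11} − L_{σ,22} − 2i L_{σ,12}, viewed as a complex-valued function of w = u + iv, is holomorphic on the interior of B, i.e. ∂_w̄ 𝓗_σ ≡ 0 where Φ_w̄ := (Φ_u + iΦ_v)/2. -/
open scoped RealInnerProductSpace BigOperators
open MeasureTheory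

noncomputable section

/-- Partial derivative in the first coordinate direction `u`. -/
def pdu {F : Type*} [NormedAddCommGroup F] [NormedSpace ℝ F]
    (f : ℝ × ℝ → F) (p : ℝ × ℝ) : F :=
  fderiv ℝ f p (1, 0)

/-- Partial derivative in the second coordinate direction `v`. -/
def pdv {F : Type*} [NormedAddCommGroup F] [NormedSpace ℝ F]
    (f : ℝ × ℝ → F) (p : ℝ × ℝ) : F :=
  fderiv ℝ f p (0, 1)

/-- The closed unit disc `B ⊆ ℝ²`. -/
def Disc : Set (ℝ × ℝ) := Metric.closedBall 0 1

/-- Coefficient `L_{N,11} = ⟨X_uu, N⟩` of the second fundamental form. -/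
def L11 {d : ℕ} (X Nσ : ℝ × ℝ → EuclideanSpace ℝ (Fin d)) (p : ℝ × ℝ) : ℝ :=
  ⟪pdu (pdu X) p, Nσ p⟫

/-- Coefficient `L_{N,12} = ⟨X_uv, N⟩` of the second fundamental form. -/
def L12 {d : ℕ} (X Nσ : ℝ × ℝ → EuclideanSpace ℝ (Fin d)) (p : ℝ × ℝ) : ℝ :=
  ⟪pdv (pdu X) p, Nσ p⟫

/-- Coefficient `L_{N,22} = ⟨X_vv, N⟩` of the second fundamental form. -/
def L22 {d : ℕ} (X Nσ : ℝ × ℝ → EuclideanSpace ℝ (Fin d)) (p : ℝ × ℝ) : ℝ :=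
  ⟪pdv (pdv X) p, Nσ p⟫

/-- Torsion coefficient `T_{σ,1}^ω = ⟨N_{σ,u}, N_ω⟩` (set to `0` when `σ = ω`). -/
def Tor1 {d k : ℕ} (N : Fin k → ℝ × ℝ → EuclideanSpace ℝ (Fin d)) (σ ω : Fin k)
    (q : ℝ × ℝ) : ℝ :=
  if σ = ω then 0 else ⟪pdu (N σ) q, N ω q⟫

/-- Torsion coefficient `T_{σ,2}^ω = ⟨N_{σ,v}, N_ω⟩` (set to `0` when `σ = ω`). -/
def Tor2 {d k : ℕ} (N : Fin k → ℝ × ℝ → EuclideanSpace ℝ (Fin d)) (σ ω : Fin k)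
    (q : ℝ × ℝ) : ℝ :=
  if σ = ω then 0 else ⟪pdv (N σ) q, N ω q⟫

/-- The normal variation `X̃ = X + ε φ N_γ̂` with `N_γ̂ = ∑_σ γ̂^σ N_σ`. -/
def Xvar {d k : ℕ} (X : ℝ × ℝ → EuclideanSpace ℝ (Fin d)) (φ : ℝ × ℝ → ℝ)
    (γ : Fin k → ℝ × ℝ → ℝ) (N : Fin k → ℝ × ℝ → EuclideanSpace ℝ (Fin d))
    (ε : ℝ) (q : ℝ × ℝ) : EuclideanSpace ℝ (Fin d) :=
  X q + (ε * φ q) • ∑ σ, γ σ q • N σ q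

/-- The Hopf function `𝓗_N = L_{N,11} − L_{N,22} − 2i L_{N,12}` along a normal `N`. -/
def Hopf {d : ℕ} (X Nσ : ℝ × ℝ → EuclideanSpace ℝ (Fin d)) (q : ℝ × ℝ) : ℂ :=
  Complex.ofReal (L11 X Nσ q - L22 X Nσ q) - 2 * Complex.I * Complex.ofReal (L12 X Nσ q)

theorem eventually_of_forall_mem_disc {p : ℝ × ℝ} {P : ℝ × ℝ → Prop}
    (hp : p ∈ Metric.ball (0 : ℝ × ℝ) 1) (h : ∀ q ∈ Disc, P q) : ∀ᶠ q in nhds p, P q := by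
  filter_upwards [Metric.isOpen_ball.mem_nhds hp] with q hq
  exact h q (Metric.ball_subset_closedBall hq)

section PartialDerivatives

variable {F : Type*} [NormedAddCommGroup F] [NormedSpace ℝ F]

theorem ContDiffAt.pdu {f : ℝ × ℝ → F} {p : ℝ × ℝ} {n k : WithTop ℕ∞}
    (hf : ContDiffAt ℝ n f p) (hk : k + 1 ≤ n) : ContDiffAt ℝ k (pdu f) p :=
  (hf.fderiv_right hk).clm_apply contDiffAt_const

theorem ContDiffAt.pdv {f : ℝ × ℝ → F} {p : ℝ × ℝ} {n k : WithTop ℕ∞}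
    (hf : ContDiffAt ℝ n f p) (hk : k + 1 ≤ n) : ContDiffAt ℝ k (pdv f) p :=
  (hf.fderiv_right hk).clm_apply contDiffAt_const

theorem pdu_congr {f g : ℝ × ℝ → F} {p : ℝ × ℝ} (h : f =ᶠ[nhds p] g) : pdu f p = pdu g p := by
  simp only [pdu, h.fderiv_eq]

theorem pdv_congr {f g : ℝ × ℝ → F} {p : ℝ × ℝ} (h : f =ᶠ[nhds p] g) : pdv f p = pdv g p := by
  simp only [pdv, h.fderiv_eq]

/-- Mixed second partial derivatives commute. -/
theorem pdu_pdv_comm {f : ℝ × ℝ → F} {p : ℝ × ℝ} (hf : ContDiffAt ℝ 2 f p) :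
    pdu (pdv f) p = pdv (pdu f) p := by
  have hd : DifferentiableAt ℝ (fderiv ℝ f) p :=
    (hf.fderiv_right (m := 1) (by norm_num)).differentiableAt (by norm_num)
  have happly : ∀ e : ℝ × ℝ, ∀ e' : ℝ × ℝ,
      fderiv ℝ (fun q => fderiv ℝ f q e) p e' = fderiv ℝ (fderiv ℝ f) p e' e := by
    intro e e'
    rw [fderiv_clm_apply hd (differentiableAt_const e)]
    simp
  have hs : IsSymmSndFDerivAt ℝ f p := hf.isSymmSndFDerivAt (by simp)
  exact (happly _ _).trans ((hs.eq _ _).trans (happly _ _).symm)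

end PartialDerivatives

section Inner

variable {E : Type*} [NormedAddCommGroup E] [InnerProductSpace ℝ E]

theorem pdu_inner {f g : ℝ × ℝ → E} {p : ℝ × ℝ} (hf : DifferentiableAt ℝ f p)
    (hg : DifferentiableAt ℝ g p) :
    pdu (fun q => ⟪f q, g q⟫) p = ⟪f p, pdu g p⟫ + ⟪pdu f p, g p⟫ :=
  fderiv_inner_apply ℝ hf hg _

theorem pdv_inner {f g : ℝ × ℝ → E} {p : ℝ × ℝ} (hf : DifferentiableAt ℝ f p)
    (hg : DifferentiableAt ℝ g p) :
    pdv (fun q => ⟪f q, g q⟫) p = ⟪f p, pdv g p⟫ + ⟪pdv f p, g p⟫ :=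
  fderiv_inner_apply ℝ hf hg _

/-- A vector orthogonal to `x`, `y` and `n i`, where `x`, `y` are orthogonal and nonzero and `n` is
an orthonormal family normal to both, vanishes if these vectors are as many as the dimension. -/
theorem eq_zero_of_inner_frame_eq_zero {ι : Type*} [Fintype ι]
    [FiniteDimensional ℝ E] (hcard : Module.finrank ℝ E = 2 + Fintype.card ι)
    {x y e : E} {n : ι → E} (hx : x ≠ 0) (hy : y ≠ 0) (hxy : ⟪x, y⟫ = 0)
    (hn : Orthonormal ℝ n) (hxn : ∀ i, ⟪x, n i⟫ = 0) (hyn : ∀ i, ⟪y, n i⟫ = 0)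
    (hex : ⟪e, x⟫ = 0) (hey : ⟪e, y⟫ = 0) (hen : ∀ i, ⟪e, n i⟫ = 0) : e = 0 := by
  have hli : LinearIndependent ℝ (Sum.elim ![x, y] n) := by
    refine linearIndependent_of_ne_zero_of_inner_eq_zero (𝕜 := ℝ) ?_ ?_
    · rintro (i | i)
      · fin_cases i
        exacts [hx, hy]
      · exact hn.ne_zero i
    · rintro (i | i) (j | j) hij
      · fin_cases i <;> fin_cases j
        · exact absurd rfl hij
        · exact hxy
        · exact (real_inner_comm _ _).trans hxy
        · exact absurd rfl hij
      · fin_cases i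
        exacts [hxn j, hyn j]
      · fin_cases j
        exacts [(real_inner_comm _ _).trans (hxn i), (real_inner_comm _ _).trans (hyn i)]
      · exact hn.2 fun h => hij (congrArg Sum.inr h)
  have hspan := hli.span_eq_top_of_card_eq_finrank' (by simp [hcard])
  have hmem : e ∈ Submodule.span ℝ (Set.range (Sum.elim ![x, y] n)) := hspan ▸ Submodule.mem_top
  have horth : ∀ z ∈ Submodule.span ℝ (Set.range (Sum.elim ![x, y] n)), ⟪e, z⟫ = 0 := by
    intro z hz
    induction hz using Submodule.span_induction with
    | mem z hz =>
      obtain ⟨i | i, rfl⟩ := hz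
      · fin_cases i
        exacts [hex, hey]
      · exact hen i
    | zero => exact inner_zero_right e
    | add a b _ _ ha hb => rw [inner_add_right, ha, hb, add_zero]
    | smul c a _ ha => rw [inner_smul_right, ha, mul_zero]
  exact inner_self_eq_zero.mp (horth e hmem)

/-- A vector orthogonal to the normal frame `n` is determined by its tangential components. -/
theorem smul_eq_tangential_of_inner_normal_eq_zero {ι : Type*} [Fintype ι]
    [FiniteDimensional ℝ E] (hcard : Module.finrank ℝ E = 2 + Fintype.card ι)
    {x y a : E} {n : ι → E} {w : ℝ} (hw : 0 < w) (hxx : ⟪x, x⟫ = w) (hyy : ⟪y, y⟫ = w)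
    (hxy : ⟪x, y⟫ = 0) (hn : Orthonormal ℝ n) (hxn : ∀ i, ⟪x, n i⟫ = 0)
    (hyn : ∀ i, ⟪y, n i⟫ = 0) (han : ∀ i, ⟪a, n i⟫ = 0) :
    w • a = ⟪x, a⟫ • x + ⟪y, a⟫ • y := by
  have hx : x ≠ 0 := by
    rintro rfl
    simp only [inner_zero_left] at hxx
    exact hw.ne hxx
  have hy : y ≠ 0 := by
    rintro rfl
    simp only [inner_zero_left] at hyy
    exact hw.ne hyy
  rw [← sub_eq_zero]
  refine eq_zero_of_inner_frame_eq_zero hcard hx hy hxy hn hxn hyn ?_ ?_ fun i => ?_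
  · simp only [inner_sub_left, inner_add_left, real_inner_smul_left, hxx, real_inner_comm x y, hxy,
      real_inner_comm x a]
    ring
  · simp only [inner_sub_left, inner_add_left, real_inner_smul_left, hyy, hxy,
      real_inner_comm y a]
    ring
  · simp only [inner_sub_left, inner_add_left, real_inner_smul_left, hxn, hyn, han]
    ring

end Inner

theorem fderiv_ofReal_sub_two_I_mul_ofReal {A B : ℝ × ℝ → ℝ} {p : ℝ × ℝ}
    (hA : DifferentiableAt ℝ A p) (hB : DifferentiableAt ℝ B p) (e : ℝ × ℝ) :
    fderiv ℝ (fun q => (A q : ℂ) - 2 * Complex.I * (B q : ℂ)) p e =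
      (fderiv ℝ A p e : ℂ) - 2 * Complex.I * (fderiv ℝ B p e : ℂ) := by
  have hA' := Complex.ofRealCLM.hasFDerivAt.comp p hA.hasFDerivAt
  have hB' := (Complex.ofRealCLM.hasFDerivAt.comp p hB.hasFDerivAt).const_mul (2 * Complex.I)
  have h := (hA'.sub hB').fderiv
  have h' := congrArg (fun T : ℝ × ℝ →L[ℝ] ℂ => T e) h
  have hfun : (fun q => (A q : ℂ) - 2 * Complex.I * (B q : ℂ)) =
      Complex.ofRealCLM ∘ A - fun q => 2 * Complex.I * (Complex.ofRealCLM ∘ B) q := rfl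
  rw [hfun]
  exact h'

/-- Holomorphy of the Hopf functions for minimal surfaces with torsion-free frame. -/
theorem hopf_functions_holomorphic
    (m : ℕ)
    (X : ℝ × ℝ → EuclideanSpace ℝ (Fin (m + 3)))
    (hX : ContDiffOn ℝ 3 X Disc)
    (W : ℝ × ℝ → ℝ)
    (hWpos : ∀ p ∈ Disc, 0 < W p)
    (hconfu : ∀ p ∈ Disc, ⟪pdu X p, pdu X p⟫ = W p)
    (hconfv : ∀ p ∈ Disc, ⟪pdv X p, pdv X p⟫ = W p)
    (hconfuv : ∀ p ∈ Disc, ⟪pdu X p, pdv X p⟫ = 0)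
    (N : Fin (m + 1) → ℝ × ℝ → EuclideanSpace ℝ (Fin (m + 3)))
    (hN : ∀ σ, ContDiffOn ℝ 2 (N σ) Disc)
    (hNXu : ∀ σ, ∀ p ∈ Disc, ⟪pdu X p, N σ p⟫ = 0)
    (hNXv : ∀ σ, ∀ p ∈ Disc, ⟪pdv X p, N σ p⟫ = 0)
    (hNN : ∀ σ ω, ∀ p ∈ Disc, ⟪N σ p, N ω p⟫ = if σ = ω then 1 else 0)
    -- X is minimal: `H_σ ≡ 0` for all `σ`
    (hminimal : ∀ σ, ∀ p ∈ Disc, (L11 X (N σ) p + L22 X (N σ) p) / (2 * W p) = 0)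
    -- the orthonormal normal section is torsion-free
    (htorsionfree : ∀ σ ω, ∀ p ∈ Disc, Tor1 N σ ω p = 0 ∧ Tor2 N σ ω p = 0)
    : ∀ σ, ∀ p ∈ Metric.ball (0 : ℝ × ℝ) 1,
      (pdu (Hopf X (N σ)) p + Complex.I * pdv (Hopf X (N σ)) p) / 2 = 0 := by
  intro σ p hp
  have hpD : p ∈ Disc := Metric.ball_subset_closedBall hp
  have hnhds : Disc ∈ nhds p :=
    Filter.mem_of_superset (Metric.isOpen_ball.mem_nhds hp) Metric.ball_subset_closedBall
  have hX3 : ContDiffAt ℝ 3 X p := hX.contDiffAt hnhds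
  have hNd : ∀ ω, DifferentiableAt ℝ (N ω) p := fun ω =>
    ((hN ω).contDiffAt hnhds).differentiableAt (by norm_num)
  have hu2 : ContDiffAt ℝ 2 (pdu X) p := hX3.pdu (by norm_num)
  have hv2 : ContDiffAt ℝ 2 (pdv X) p := hX3.pdv (by norm_num)
  have hu := hu2.differentiableAt (by norm_num)
  have hv := hv2.differentiableAt (by norm_num)
  have huu := (hu2.pdu (k := 1) (by norm_num)).differentiableAt (by norm_num)
  have huv := (hu2.pdv (k := 1) (by norm_num)).differentiableAt (by norm_num)
  have hvv := (hv2.pdv (k := 1) (by norm_num)).differentiableAt (by norm_num)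
  -- symmetry of second and third derivatives
  have hcomm : pdu (pdv X) =ᶠ[nhds p] pdv (pdu X) := by
    filter_upwards [(hX3.of_le (m := 2) (by norm_num)).eventually (by simp)] with q hq
    exact pdu_pdv_comm hq
  have hcommp := hcomm.eq_of_nhds
  have hcomm3u : pdu (pdv (pdu X)) p = pdv (pdu (pdu X)) p := pdu_pdv_comm hu2
  have hcomm3v : pdu (pdv (pdv X)) p = pdv (pdv (pdu X)) p :=
    (pdu_pdv_comm hv2).trans (pdv_congr hcomm)
  -- derivatives of the conformality relations
  have hconf : (fun q => ⟪pdu X q, pdu X q⟫) =ᶠ[nhds p] fun q => ⟪pdv X q, pdv X q⟫ :=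
    eventually_of_forall_mem_disc hp fun q hq => (hconfu q hq).trans (hconfv q hq).symm
  have horth : (fun q => ⟪pdu X q, pdv X q⟫) =ᶠ[nhds p] fun _ => (0 : ℝ) :=
    eventually_of_forall_mem_disc hp hconfuv
  have hcu := pdu_congr hconf
  have hcv := pdv_congr hconf
  have hou := pdu_congr horth
  have hov := pdv_congr horth
  rw [pdu_inner hu hu, pdu_inner hv hv, hcommp] at hcu
  rw [pdv_inner hu hu, pdv_inner hv hv] at hcv
  rw [pdu_inner hu hv, hcommp] at hou
  rw [pdv_inner hu hv] at hov
  -- the derivatives of the normal are tangential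
  have hTor : (∀ ω, ⟪pdu (N σ) p, N ω p⟫ = 0) ∧ ∀ ω, ⟪pdv (N σ) p, N ω p⟫ = 0 := by
    have hunit : (fun q => ⟪N σ q, N σ q⟫) =ᶠ[nhds p] fun _ => (1 : ℝ) :=
      eventually_of_forall_mem_disc hp fun q hq => by simpa using hNN σ σ q hq
    have h1 := pdu_congr hunit
    have h2 := pdv_congr hunit
    rw [pdu_inner (hNd σ) (hNd σ), real_inner_comm] at h1
    rw [pdv_inner (hNd σ) (hNd σ), real_inner_comm] at h2
    simp only [pdu, pdv, fderiv_fun_const, Pi.zero_apply, zero_apply] at h1 h2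
    refine ⟨fun ω => ?_, fun ω => ?_⟩ <;> by_cases hω : σ = ω
    · subst hω
      simp only [pdu]
      linarith
    · simpa [Tor1, hω] using (htorsionfree σ ω p hpD).1
    · subst hω
      simp only [pdv]
      linarith
    · simpa [Tor2, hω] using (htorsionfree σ ω p hpD).2
  have hON : Orthonormal ℝ fun ω => N ω p :=
    orthonormal_iff_ite.mpr fun i j => hNN i j p hpD
  have hfin : Module.finrank ℝ (EuclideanSpace ℝ (Fin (m + 3))) = 2 + Fintype.card (Fin (m + 1)) := by
    simp only [finrank_euclideanSpace, Fintype.card_fin]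
    omega
  have hweinu := smul_eq_tangential_of_inner_normal_eq_zero hfin (hWpos p hpD) (hconfu p hpD)
    (hconfv p hpD) (hconfuv p hpD) hON (fun ω => hNXu ω p hpD) (fun ω => hNXv ω p hpD) hTor.1
  have hweinv := smul_eq_tangential_of_inner_normal_eq_zero hfin (hWpos p hpD) (hconfu p hpD)
    (hconfv p hpD) (hconfuv p hpD) hON (fun ω => hNXu ω p hpD) (fun ω => hNXv ω p hpD) hTor.2
  have hnu : (fun q => ⟪pdu X q, N σ q⟫) =ᶠ[nhds p] fun _ => (0 : ℝ) :=
    eventually_of_forall_mem_disc hp (hNXu σ)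
  have hnv : (fun q => ⟪pdv X q, N σ q⟫) =ᶠ[nhds p] fun _ => (0 : ℝ) :=
    eventually_of_forall_mem_disc hp (hNXv σ)
  have hnuu := pdu_congr hnu
  have hnuv := pdv_congr hnu
  have hnvu := pdu_congr hnv
  have hnvv := pdv_congr hnv
  rw [pdu_inner hu (hNd σ)] at hnuu
  rw [pdv_inner hu (hNd σ)] at hnuv
  rw [pdu_inner hv (hNd σ), hcommp] at hnvu
  rw [pdv_inner hv (hNd σ)] at hnvv
  have hc0u : pdu (fun _ : ℝ × ℝ => (0 : ℝ)) p = 0 := by simp [pdu]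
  have hc0v : pdv (fun _ : ℝ × ℝ => (0 : ℝ)) p = 0 := by simp [pdv]
  rw [hc0u] at hnuu hnvu hou
  rw [hc0v] at hnuv hnvv hov
  -- minimality
  have hmin : L22 X (N σ) =ᶠ[nhds p] fun q => -L11 X (N σ) q := by
    refine eventually_of_forall_mem_disc hp fun q hq => ?_
    have h := hminimal σ q hq
    rw [div_eq_zero_iff, or_iff_left (by linarith [hWpos q hq] : ¬ 2 * W q = 0)] at h
    linarith
  have hminp : ⟪pdv (pdv X) p, N σ p⟫ = -⟪pdu (pdu X) p, N σ p⟫ := hmin.eq_of_nhds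
  have hd11 : DifferentiableAt ℝ (L11 X (N σ)) p := huu.inner ℝ (hNd σ)
  have hd12 : DifferentiableAt ℝ (L12 X (N σ)) p := huv.inner ℝ (hNd σ)
  have hneg : ∀ e, fderiv ℝ (L22 X (N σ)) p e = -fderiv ℝ (L11 X (N σ)) p e := by
    intro e
    rw [hmin.fderiv_eq, fderiv_fun_neg]
    rfl
  have huuu : ⟪pdu (pdu X) p, pdu X p⟫ = ⟪pdv (pdu X) p, pdv X p⟫ := by
    linarith [real_inner_comm (pdu X p) (pdu (pdu X) p), real_inner_comm (pdv X p) (pdv (pdu X) p)]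
  have huuv : ⟪pdu (pdu X) p, pdv X p⟫ = -⟪pdv (pdu X) p, pdu X p⟫ := by
    linarith [real_inner_comm (pdu X p) (pdv (pdu X) p)]
  have hvvu : ⟪pdv (pdv X) p, pdu X p⟫ = -⟪pdv (pdu X) p, pdv X p⟫ := by
    linarith [real_inner_comm (pdu X p) (pdv (pdv X) p)]
  have hvvv : ⟪pdv (pdv X) p, pdv X p⟫ = ⟪pdv (pdu X) p, pdu X p⟫ := by
    linarith [real_inner_comm (pdv X p) (pdv (pdv X) p), real_inner_comm (pdu X p) (pdv (pdu X) p)]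
  -- the Codazzi equations
  have hsplit : ∀ {z a : EuclideanSpace ℝ (Fin (m + 3))},
      W p • a = ⟪pdu X p, a⟫ • pdu X p + ⟪pdv X p, a⟫ • pdv X p →
      W p * ⟪z, a⟫ = ⟪pdu X p, a⟫ * ⟪z, pdu X p⟫ + ⟪pdv X p, a⟫ * ⟪z, pdv X p⟫ := by
    intro z a h
    rw [← real_inner_smul_right, h, inner_add_right, real_inner_smul_right, real_inner_smul_right]
  have hcodu : pdv (L11 X (N σ)) p = pdu (L12 X (N σ)) p := by
    have h1 : pdv (L11 X (N σ)) p = _ := pdv_inner huu (hNd σ)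
    have h2 : pdu (L12 X (N σ)) p = _ := pdu_inner huv (hNd σ)
    rw [h1, h2, hcomm3u]
    congr 1
    apply mul_left_cancel₀ (hWpos p hpD).ne'
    rw [hsplit hweinu, hsplit hweinv, eq_neg_of_add_eq_zero_left hnuu,
      eq_neg_of_add_eq_zero_left hnuv, eq_neg_of_add_eq_zero_left hnvu,
      eq_neg_of_add_eq_zero_left hnvv, hminp]
    rw [huuu, huuv]
    ring
  have hcodv : pdv (L12 X (N σ)) p = pdu (L22 X (N σ)) p := by
    have h1 : pdv (L12 X (N σ)) p = _ := pdv_inner huv (hNd σ)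
    have h2 : pdu (L22 X (N σ)) p = _ := pdu_inner hvv (hNd σ)
    rw [h1, h2, hcomm3v]
    congr 1
    apply mul_left_cancel₀ (hWpos p hpD).ne'
    rw [hsplit hweinu, hsplit hweinv, eq_neg_of_add_eq_zero_left hnuu,
      eq_neg_of_add_eq_zero_left hnuv, eq_neg_of_add_eq_zero_left hnvu,
      eq_neg_of_add_eq_zero_left hnvv, hminp]
    rw [hvvu, hvvv]
    ring
  have hd22 : DifferentiableAt ℝ (L22 X (N σ)) p := hvv.inner ℝ (hNd σ)
  have hHopf : ∀ e, fderiv ℝ (Hopf X (N σ)) p e =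
      ((fderiv ℝ (L11 X (N σ)) p e - fderiv ℝ (L22 X (N σ)) p e : ℝ) : ℂ) -
        2 * Complex.I * (fderiv ℝ (L12 X (N σ)) p e : ℂ) := by
    intro e
    refine (fderiv_ofReal_sub_two_I_mul_ofReal (hd11.fun_sub hd22) hd12 e).trans ?_
    rw [fderiv_fun_sub hd11 hd22]
    rfl
  simp only [pdu, pdv] at hcodu hcodv ⊢
  rw [hHopf, hHopf, ← hcodu, hcodv, hneg (0, 1), hneg (1, 0)]
  push_cast
  linear_combination (fderiv ℝ (L11 X (N σ)) p (1, 0) : ℂ) * Complex.I_sq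
end
end

section
/- Curvature bound for the auxiliary conformal metric (K̂ ≤ 1): let X be minimal (H_σ ≡ 0 for all σ) with a torsion-free orthonormal normal section (T_{σ,i}^ω ≡ 0), let κ₀ > 0 be a real constant, and set γ := κ₀ − K > 0 where K := Σ_σ K_σ ≤ 0. Then, with Wirtinger derivatives Φ_w := (Φ_u − iΦ_v)/2 and Φ_w̄ := (Φ_u + iΦ_v)/2 in w = u + iv, the inequality γ_w γ_w̄ − γ γ_{ww̄} ≤ (γ³/2)W − (γ²/2)KW holds on the interior of B; equivalently, the Gaussian curvature K̂ of the conformal metric with coefficients ĝ_ij := γ g_ij, determined by γ³K̂ = γ²K + (2/W)(γ_w γ_w̄ − γ γ_{ww̄}), satisfies K̂ ≤ 1. -/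
open scoped RealInnerProductSpace BigOperators
open MeasureTheory

noncomputable section

/-- The (total) Gaussian curvature `K = Σ_σ K_σ`. -/
def Ktot {m : ℕ} (X : ℝ × ℝ → EuclideanSpace ℝ (Fin (m + 3))) (W : ℝ × ℝ → ℝ)
    (N : Fin (m + 1) → ℝ × ℝ → EuclideanSpace ℝ (Fin (m + 3))) (q : ℝ × ℝ) : ℝ :=
  ∑ σ, (L11 X (N σ) q * L22 X (N σ) q - (L12 X (N σ) q) ^ 2) / (W q) ^ 2

section DirectionalDerivatives

variable {E F G : Type*} [NormedAddCommGroup E] [NormedSpace ℝ E]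
  [NormedAddCommGroup F] [NormedSpace ℝ F] [NormedAddCommGroup G] [InnerProductSpace ℝ G]
  {U : Set E} {p : E}

theorem ContDiffOn.fderiv_apply_const {n : ℕ} {f : E → F} (hU : IsOpen U)
    (hf : ContDiffOn ℝ (n + 1) f U) (e : E) :
    ContDiffOn ℝ n (fun q => fderiv ℝ f q e) U :=
  (hf.fderiv_of_isOpen hU le_rfl).clm_apply contDiffOn_const

theorem ContDiffOn.differentiableAt_of_isOpen {n : ℕ} {f : E → F} (hU : IsOpen U)
    (hf : ContDiffOn ℝ (n + 1) f U) (hp : p ∈ U) : DifferentiableAt ℝ f p :=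
  (hf.contDiffAt (hU.mem_nhds hp)).differentiableAt (by norm_cast)

theorem Set.EqOn.fderiv_eq {f g : E → F} (hU : IsOpen U) (h : Set.EqOn f g U) (hp : p ∈ U) :
    fderiv ℝ f p = fderiv ℝ g p :=
  (h.eventuallyEq_of_mem (hU.mem_nhds hp)).fderiv_eq

theorem fderiv_fderiv_apply_comm {f : E → F} (hU : IsOpen U) (hf : ContDiffOn ℝ 2 f U)
    (hp : p ∈ U) (e e' : E) :
    fderiv ℝ (fun q => fderiv ℝ f q e) p e' = fderiv ℝ (fun q => fderiv ℝ f q e') p e := by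
  have hf' : DifferentiableAt ℝ (fderiv ℝ f) p :=
    ((hf.fderiv_of_isOpen (m := 1) hU (by norm_num)).contDiffAt
      (hU.mem_nhds hp)).differentiableAt (by norm_num)
  have hs := (hf.contDiffAt (hU.mem_nhds hp)).isSymmSndFDerivAt (by simp)
  rw [fderiv_clm_apply hf' (differentiableAt_const _),
    fderiv_clm_apply hf' (differentiableAt_const _)]
  simpa using hs e' e

theorem fderiv_mul_apply' {f g : E → ℝ} (hf : DifferentiableAt ℝ f p)
    (hg : DifferentiableAt ℝ g p) (e : E) :
    fderiv ℝ (fun q => f q * g q) p e = fderiv ℝ f p e * g p + f p * fderiv ℝ g p e := by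
  rw [fderiv_fun_mul hf hg]
  simp
  ring

theorem fderiv_fderiv_mul_apply {f g : E → ℝ} (hU : IsOpen U) (hf : ContDiffOn ℝ 2 f U)
    (hg : ContDiffOn ℝ 2 g U) (hp : p ∈ U) (e : E) :
    fderiv ℝ (fun q => fderiv ℝ (fun r => f r * g r) q e) p e =
      fderiv ℝ (fun q => fderiv ℝ f q e) p e * g p + 2 * (fderiv ℝ f p e * fderiv ℝ g p e) +
        f p * fderiv ℝ (fun q => fderiv ℝ g q e) p e := by
  have hf1 {q} (hq : q ∈ U) := ContDiffOn.differentiableAt_of_isOpen (n := 1) hU hf hq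
  have hg1 {q} (hq : q ∈ U) := ContDiffOn.differentiableAt_of_isOpen (n := 1) hU hg hq
  have hf2 := ContDiffOn.differentiableAt_of_isOpen (n := 0) hU
    (ContDiffOn.fderiv_apply_const (n := 1) hU hf e) hp
  have hg2 := ContDiffOn.differentiableAt_of_isOpen (n := 0) hU
    (ContDiffOn.fderiv_apply_const (n := 1) hU hg e) hp
  rw [Set.EqOn.fderiv_eq hU (fun q hq => fderiv_mul_apply' (hf1 hq) (hg1 hq) e) hp,
    fderiv_fun_add (hf2.fun_mul (hg1 hp)) ((hf1 hp).fun_mul hg2), add_apply,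
    fderiv_mul_apply' hf2 (hg1 hp), fderiv_mul_apply' (hf1 hp) hg2]
  ring

theorem fderiv_fderiv_inner_self_apply {f : E → G} (hU : IsOpen U) (hf : ContDiffOn ℝ 2 f U)
    (hp : p ∈ U) (e : E) :
    fderiv ℝ (fun q => fderiv ℝ (fun r => ⟪f r, f r⟫) q e) p e =
      2 * (⟪f p, fderiv ℝ (fun q => fderiv ℝ f q e) p e⟫ + ⟪fderiv ℝ f p e, fderiv ℝ f p e⟫) := by
  have hf1 {q} (hq : q ∈ U) := ContDiffOn.differentiableAt_of_isOpen (n := 1) hU hf hq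
  have hf2 := ContDiffOn.differentiableAt_of_isOpen (n := 0) hU
    (ContDiffOn.fderiv_apply_const (n := 1) hU hf e) hp
  rw [Set.EqOn.fderiv_eq hU (fun q hq => fderiv_inner_apply ℝ (hf1 hq) (hf1 hq) e) hp,
    fderiv_fun_add ((hf1 hp).inner ℝ hf2) (hf2.inner ℝ (hf1 hp)), add_apply,
    fderiv_inner_apply ℝ (hf1 hp) hf2, fderiv_inner_apply ℝ hf2 (hf1 hp),
    real_inner_comm (f p)]
  ring

theorem fderiv_fderiv_sum_apply {ι : Type*} [Fintype ι] {f : ι → E → F} (hU : IsOpen U)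
    (hf : ∀ i, ContDiffOn ℝ 2 (f i) U) (hp : p ∈ U) (e : E) :
    fderiv ℝ (fun q => fderiv ℝ (fun r => ∑ i, f i r) q e) p e =
      ∑ i, fderiv ℝ (fun q => fderiv ℝ (f i) q e) p e := by
  have h : Set.EqOn (fun q => fderiv ℝ (fun r => ∑ i, f i r) q e)
      (fun q => ∑ i, fderiv ℝ (f i) q e) U := fun q hq => by
    simp [fderiv_fun_sum fun i _ =>
      ContDiffOn.differentiableAt_of_isOpen (n := 1) hU (hf i) hq]
  rw [h.fderiv_eq hU hp, fderiv_fun_sum fun i _ =>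
    ContDiffOn.differentiableAt_of_isOpen (n := 0) hU
      (ContDiffOn.fderiv_apply_const (n := 1) hU (hf i) e) hp]
  simp

end DirectionalDerivatives

section CauchyRiemann

theorem sq_add_sq_le_of_conjugate_pairs {ι : Type*} [Fintype ι] (x y r t : ι → ℝ) :
    (∑ i, (x i * r i + y i * t i)) ^ 2 + (∑ i, (x i * t i - y i * r i)) ^ 2 ≤
      (∑ i, (x i ^ 2 + y i ^ 2)) * ∑ i, (r i ^ 2 + t i ^ 2) := by
  set A := ∑ i, (x i * r i + y i * t i) with hA
  set B := ∑ i, (x i * t i - y i * r i) with hB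
  set S := ∑ i, (r i ^ 2 + t i ^ 2) with hS
  set a := ∑ i, (x i ^ 2 + y i ^ 2) with ha
  have hS0 : 0 ≤ S := Finset.sum_nonneg fun i _ => by positivity
  have key : ∑ i, ((S * x i - A * r i - B * t i) ^ 2 + (S * y i - A * t i + B * r i) ^ 2) =
      S * (S * a - A ^ 2 - B ^ 2) := by
    have h : ∀ i, (S * x i - A * r i - B * t i) ^ 2 + (S * y i - A * t i + B * r i) ^ 2 =
        S ^ 2 * (x i ^ 2 + y i ^ 2) + (-(2 * S * A)) * (x i * r i + y i * t i) +
          (-(2 * S * B)) * (x i * t i - y i * r i) +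
          (A ^ 2 + B ^ 2) * (r i ^ 2 + t i ^ 2) := fun i => by ring
    rw [Finset.sum_congr rfl fun i _ => h i, Finset.sum_add_distrib, Finset.sum_add_distrib,
      Finset.sum_add_distrib, ← Finset.mul_sum, ← Finset.mul_sum, ← Finset.mul_sum,
      ← Finset.mul_sum]
    rw [← ha, ← hA, ← hB, ← hS]
    ring
  have hnn : 0 ≤ S * (S * a - A ^ 2 - B ^ 2) :=
    key ▸ Finset.sum_nonneg fun i _ => by positivity
  rcases hS0.lt_or_eq with hpos | hzero
  · nlinarith [nonneg_of_mul_nonneg_right hnn hpos]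
  · have hrt : ∀ i, r i ^ 2 + t i ^ 2 = 0 := fun i =>
      (Finset.sum_eq_zero_iff_of_nonneg fun i _ => by positivity).1 hzero.symm i
        (Finset.mem_univ i)
    have hr : ∀ i, r i = 0 := fun i => by nlinarith [hrt i, sq_nonneg (r i), sq_nonneg (t i)]
    have ht : ∀ i, t i = 0 := fun i => by nlinarith [hrt i, sq_nonneg (r i), sq_nonneg (t i)]
    simp [hA, hB, ← hzero, hr, ht]

variable {U : Set (ℝ × ℝ)}

/-- A `C¹` solution of the Cauchy–Riemann equations is `C²`. -/
theorem contDiffOn_two_of_cauchyRiemann {x y : ℝ × ℝ → ℝ} (hU : IsOpen U)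
    (hx : ContDiffOn ℝ 1 x U) (hy : ContDiffOn ℝ 1 y U)
    (h1 : ∀ p ∈ U, pdu x p = -pdv y p) (h2 : ∀ p ∈ U, pdv x p = pdu y p) :
    ContDiffOn ℝ 2 x U ∧ ContDiffOn ℝ 2 y U := by
  set c : ℂ →L[ℝ] ℝ × ℝ := Complex.reCLM.prod Complex.imCLM with hc
  set d : ℝ × ℝ → ℂ := fun q => (q.1 : ℂ) + q.2 * Complex.I with hd
  have hd' : ContDiff ℝ 2 d :=
    (Complex.ofRealCLM.contDiff.comp contDiff_fst).add
      ((Complex.ofRealCLM.contDiff.comp contDiff_snd).mul contDiff_const)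
  have hcd : ∀ q, c (d q) = q := fun q => by ext <;> simp [hc, hd]
  set H : ℂ → ℂ := fun z => (x (c z) : ℂ) - y (c z) * Complex.I with hH
  have hV : IsOpen (c ⁻¹' U) := hU.preimage c.continuous
  have hHd : DifferentiableOn ℂ H (c ⁻¹' U) := by
    intro z hz
    refine DifferentiableAt.differentiableWithinAt ?_
    have hxz := ((ContDiffOn.differentiableAt_of_isOpen (n := 0) hU hx hz).hasFDerivAt.comp z
      c.hasFDerivAt)
    have hyz := ((ContDiffOn.differentiableAt_of_isOpen (n := 0) hU hy hz).hasFDerivAt.comp z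
      c.hasFDerivAt)
    have hHz := (Complex.ofRealCLM.hasFDerivAt.comp z hxz).sub
      ((Complex.ofRealCLM.hasFDerivAt.comp z hyz).mul_const Complex.I)
    have hHz' : HasFDerivAt H _ z := hHz
    rw [differentiableAt_complex_iff_differentiableAt_real]
    refine ⟨hHz'.differentiableAt, ?_⟩
    have e1 := h1 _ hz
    have e2 := h2 _ hz
    simp only [pdu, pdv] at e1 e2
    rw [hHz'.fderiv]
    apply Complex.ext <;> simp [hc] <;> simp [hc] at e1 e2 <;> linarith
  have hHC : ContDiffOn ℝ 2 (H ∘ d) U :=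
    ((hHd.contDiffOn hV).restrict_scalars ℝ).comp hd'.contDiffOn
      (fun q hq => by simpa [hcd] using hq)
  constructor
  · refine (Complex.reCLM.contDiff.comp_contDiffOn hHC).congr fun q _ => ?_
    simp [hH, hcd]
  · refine (Complex.imCLM.contDiff.comp_contDiffOn hHC).neg.congr fun q _ => ?_
    simp [hH, hcd]

/-- Logarithmic subharmonicity of the squared norm of a holomorphic vector. -/
theorem log_subharmonic_sum_sq_of_cauchyRiemann {ι : Type*} [Fintype ι]
    {x y : ι → ℝ × ℝ → ℝ} {a : ℝ × ℝ → ℝ} (hU : IsOpen U)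
    (hx : ∀ i, ContDiffOn ℝ 1 (x i) U) (hy : ∀ i, ContDiffOn ℝ 1 (y i) U)
    (h1 : ∀ i, ∀ p ∈ U, pdu (x i) p = -pdv (y i) p)
    (h2 : ∀ i, ∀ p ∈ U, pdv (x i) p = pdu (y i) p)
    (ha : ∀ p ∈ U, a p = ∑ i, (x i p ^ 2 + y i p ^ 2)) :
    ContDiffOn ℝ 2 a U ∧ ∀ p ∈ U,
      pdu a p ^ 2 + pdv a p ^ 2 ≤ a p * (pdu (pdu a) p + pdv (pdv a) p) ∧
      0 ≤ pdu (pdu a) p + pdv (pdv a) p ∧ (a p = 0 → pdu a p = 0 ∧ pdv a p = 0) := by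
  have hx2 i := (contDiffOn_two_of_cauchyRiemann hU (hx i) (hy i) (h1 i) (h2 i)).1
  have hy2 i := (contDiffOn_two_of_cauchyRiemann hU (hx i) (hy i) (h1 i) (h2 i)).2
  have haU : Set.EqOn a (fun p => ∑ i, (x i p * x i p + y i p * y i p)) U := fun p hp => by
    rw [ha p hp]
    exact Finset.sum_congr rfl fun i _ => by ring
  have hterm i : ContDiffOn ℝ 2 (fun p => x i p * x i p + y i p * y i p) U :=
    ((hx2 i).mul (hx2 i)).add ((hy2 i).mul (hy2 i))
  have hdx i {q} (hq : q ∈ U) :=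
    ContDiffOn.differentiableAt_of_isOpen (n := 1) hU (hx2 i) hq
  have hdy i {q} (hq : q ∈ U) :=
    ContDiffOn.differentiableAt_of_isOpen (n := 1) hU (hy2 i) hq
  have hD (e : ℝ × ℝ) {p} (hp : p ∈ U) : fderiv ℝ a p e =
      2 * ∑ i, (x i p * fderiv ℝ (x i) p e + y i p * fderiv ℝ (y i) p e) := by
    rw [haU.fderiv_eq hU hp, fderiv_fun_sum fun i _ =>
      ContDiffOn.differentiableAt_of_isOpen (n := 1) hU (hterm i) hp, Finset.mul_sum,
      sum_apply]
    refine Finset.sum_congr rfl fun i _ => ?_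
    rw [fderiv_fun_add ((hdx i hp).fun_mul (hdx i hp)) ((hdy i hp).fun_mul (hdy i hp)),
      add_apply, fderiv_mul_apply' (hdx i hp) (hdx i hp),
      fderiv_mul_apply' (hdy i hp) (hdy i hp)]
    ring
  have hDD (e : ℝ × ℝ) {p} (hp : p ∈ U) : fderiv ℝ (fun q => fderiv ℝ a q e) p e =
      2 * ∑ i, (fderiv ℝ (x i) p e ^ 2 + fderiv ℝ (y i) p e ^ 2 +
        x i p * fderiv ℝ (fun q => fderiv ℝ (x i) q e) p e +
        y i p * fderiv ℝ (fun q => fderiv ℝ (y i) q e) p e) := by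
    have hEq : Set.EqOn (fun q => fderiv ℝ a q e)
        (fun q => fderiv ℝ (fun r => ∑ i, (x i r * x i r + y i r * y i r)) q e) U :=
      fun q hq => by simp only [haU.fderiv_eq hU hq]
    rw [hEq.fderiv_eq hU hp, fderiv_fderiv_sum_apply hU hterm hp, Finset.mul_sum]
    refine Finset.sum_congr rfl fun i _ => ?_
    have hEq' : Set.EqOn
        (fun q => fderiv ℝ (fun r => x i r * x i r + y i r * y i r) q e)
        (fun q => fderiv ℝ (fun r => x i r * x i r) q e +
          fderiv ℝ (fun r => y i r * y i r) q e) U := fun q hq => by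
      simp only [fderiv_fun_add ((hdx i hq).fun_mul (hdx i hq)) ((hdy i hq).fun_mul (hdy i hq)),
        add_apply]
    rw [hEq'.fderiv_eq hU hp, fderiv_fun_add
      (ContDiffOn.differentiableAt_of_isOpen (n := 0) hU (ContDiffOn.fderiv_apply_const
        (n := 1) hU ((hx2 i).mul (hx2 i)) e) hp)
      (ContDiffOn.differentiableAt_of_isOpen (n := 0) hU (ContDiffOn.fderiv_apply_const
        (n := 1) hU ((hy2 i).mul (hy2 i)) e) hp),
      add_apply, fderiv_fderiv_mul_apply hU (hx2 i) (hx2 i) hp,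
      fderiv_fderiv_mul_apply hU (hy2 i) (hy2 i) hp]
    ring
  refine ⟨(ContDiffOn.sum fun i _ => hterm i).congr haU, fun p hp => ?_⟩
  have hharm i : pdu (pdu (x i)) p + pdv (pdv (x i)) p = 0 ∧
      pdu (pdu (y i)) p + pdv (pdv (y i)) p = 0 := by
    have sx : pdu (pdv (x i)) p = pdv (pdu (x i)) p :=
      fderiv_fderiv_apply_comm hU (hx2 i) hp _ _
    have sy : pdu (pdv (y i)) p = pdv (pdu (y i)) p :=
      fderiv_fderiv_apply_comm hU (hy2 i) hp _ _
    have g1 : Set.EqOn (pdu (x i)) (fun q => -pdv (y i) q) U := fun q hq => h1 i q hq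
    have g1' : Set.EqOn (pdv (y i)) (fun q => -pdu (x i) q) U := fun q hq => by
      simp [h1 i q hq]
    have g2 : Set.EqOn (pdv (x i)) (pdu (y i)) U := fun q hq => h2 i q hq
    have a1 : pdu (pdu (x i)) p = -pdu (pdv (y i)) p := by
      simp only [pdu] at g1 ⊢
      rw [g1.fderiv_eq hU hp]; simp
    have a2 : pdv (pdv (x i)) p = pdv (pdu (y i)) p := by
      unfold pdv at g2 ⊢
      rw [g2.fderiv_eq hU hp]
    have a3 : pdu (pdu (y i)) p = pdu (pdv (x i)) p := by
      unfold pdu at g2 ⊢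
      rw [g2.fderiv_eq hU hp]
    have a4 : pdv (pdv (y i)) p = -pdv (pdu (x i)) p := by
      simp only [pdv] at g1' ⊢
      rw [g1'.fderiv_eq hU hp]; simp
    constructor <;> linarith
  have hlap : pdu (pdu a) p + pdv (pdv a) p =
      4 * ∑ i, (pdu (x i) p ^ 2 + pdv (x i) p ^ 2) := by
    have e1 := hDD (1, 0) hp
    have e2 := hDD (0, 1) hp
    change pdu (pdu a) p = 2 * ∑ i, (pdu (x i) p ^ 2 + pdu (y i) p ^ 2 +
      x i p * pdu (pdu (x i)) p + y i p * pdu (pdu (y i)) p) at e1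
    change pdv (pdv a) p = 2 * ∑ i, (pdv (x i) p ^ 2 + pdv (y i) p ^ 2 +
      x i p * pdv (pdv (x i)) p + y i p * pdv (pdv (y i)) p) at e2
    rw [e1, e2, ← mul_add, ← Finset.sum_add_distrib, show (4 : ℝ) = 2 * 2 by norm_num, mul_assoc,
      Finset.mul_sum _ (fun i => pdu (x i) p ^ 2 + pdv (x i) p ^ 2)]
    congr 1
    refine Finset.sum_congr rfl fun i _ => ?_
    linear_combination x i p * (hharm i).1 + y i p * (hharm i).2 +
      (pdv (y i) p - pdu (x i) p) * (h1 i p hp) - (pdu (y i) p + pdv (x i) p) * (h2 i p hp)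
  have hu : pdu a p = 2 * ∑ i, (x i p * pdu (x i) p + y i p * pdv (x i) p) := by
    refine (hD (1, 0) hp).trans ?_
    congr 1
    exact Finset.sum_congr rfl fun i _ => by rw [h2 i p hp]; rfl
  have hv : pdv a p = 2 * ∑ i, (x i p * pdv (x i) p - y i p * pdu (x i) p) := by
    refine (hD (0, 1) hp).trans ?_
    congr 1
    exact Finset.sum_congr rfl fun i _ => by rw [h1 i p hp]; unfold pdv; ring
  have hcs := sq_add_sq_le_of_conjugate_pairs (fun i => x i p) (fun i => y i p)
    (fun i => pdu (x i) p) (fun i => pdv (x i) p)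
  have hS : 0 ≤ ∑ i, (pdu (x i) p ^ 2 + pdv (x i) p ^ 2) :=
    Finset.sum_nonneg fun i _ => by positivity
  rw [← ha p hp] at hcs
  rw [hlap]
  have hle : pdu a p ^ 2 + pdv a p ^ 2 ≤
      a p * (4 * ∑ i, (pdu (x i) p ^ 2 + pdv (x i) p ^ 2)) := by
    rw [hu, hv]
    nlinarith [hcs]
  refine ⟨hle, by positivity, fun h0 => ?_⟩
  rw [h0, zero_mul] at hle
  constructor <;> nlinarith [sq_nonneg (pdu a p), sq_nonneg (pdv a p)]

end CauchyRiemann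

/-- If `f W² = a` with `log a` subharmonic and `Δ log W = 2 f W`, then `Δ log f ≥ -4 f W`. -/
theorem laplacian_quotient_bounds {U : Set (ℝ × ℝ)} {f W a : ℝ × ℝ → ℝ} {p : ℝ × ℝ}
    (hU : IsOpen U) (hp : p ∈ U) (hf : ContDiffOn ℝ 2 f U) (hW : ContDiffOn ℝ 2 W U)
    (hWp : 0 < W p) (hfp : 0 ≤ f p) (ha : Set.EqOn a (fun q => f q * (W q * W q)) U)
    (hgauss : W p * (pdu (pdu W) p + pdv (pdv W) p) - (pdu W p ^ 2 + pdv W p ^ 2) =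
      2 * f p * W p ^ 3)
    (hsub : pdu a p ^ 2 + pdv a p ^ 2 ≤ a p * (pdu (pdu a) p + pdv (pdv a) p))
    (hlap : 0 ≤ pdu (pdu a) p + pdv (pdv a) p)
    (hgrad : a p = 0 → pdu a p = 0 ∧ pdv a p = 0) :
    pdu f p ^ 2 + pdv f p ^ 2 - f p * (pdu (pdu f) p + pdv (pdv f) p) ≤ 4 * f p ^ 3 * W p ∧
      -(4 * f p ^ 2 * W p) ≤ pdu (pdu f) p + pdv (pdv f) p := by
  have hdf {q} (hq : q ∈ U) := ContDiffOn.differentiableAt_of_isOpen (n := 1) hU hf hq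
  have hdW {q} (hq : q ∈ U) := ContDiffOn.differentiableAt_of_isOpen (n := 1) hU hW hq
  have hD (e : ℝ × ℝ) : fderiv ℝ a p e =
      fderiv ℝ f p e * W p ^ 2 + 2 * f p * W p * fderiv ℝ W p e := by
    rw [ha.fderiv_eq hU hp, fderiv_mul_apply' (hdf hp) ((hdW hp).fun_mul (hdW hp)),
      fderiv_mul_apply' (hdW hp) (hdW hp)]
    ring
  have hDD (e : ℝ × ℝ) : fderiv ℝ (fun q => fderiv ℝ a q e) p e =
      fderiv ℝ (fun q => fderiv ℝ f q e) p e * W p ^ 2 +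
        4 * W p * fderiv ℝ f p e * fderiv ℝ W p e +
        2 * f p * (W p * fderiv ℝ (fun q => fderiv ℝ W q e) p e + fderiv ℝ W p e ^ 2) := by
    have hEq : Set.EqOn (fun q => fderiv ℝ a q e)
        (fun q => fderiv ℝ (fun r => f r * (W r * W r)) q e) U :=
      fun q hq => by simp only [ha.fderiv_eq hU hq]
    rw [hEq.fderiv_eq hU hp, fderiv_fderiv_mul_apply hU hf (hW.mul hW) hp,
      fderiv_fderiv_mul_apply hU hW hW hp, fderiv_mul_apply' (hdW hp) (hdW hp)]
    ring
  have u1 : pdu a p = pdu f p * W p ^ 2 + 2 * f p * W p * pdu W p := hD (1, 0)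
  have v1 : pdv a p = pdv f p * W p ^ 2 + 2 * f p * W p * pdv W p := hD (0, 1)
  have u2 : pdu (pdu a) p = pdu (pdu f) p * W p ^ 2 + 4 * W p * pdu f p * pdu W p +
    2 * f p * (W p * pdu (pdu W) p + pdu W p ^ 2) := hDD (1, 0)
  have v2 : pdv (pdv a) p = pdv (pdv f) p * W p ^ 2 + 4 * W p * pdv f p * pdv W p +
    2 * f p * (W p * pdv (pdv W) p + pdv W p ^ 2) := hDD (0, 1)
  have hap : a p = f p * (W p * W p) := ha hp
  have hmain : 0 ≤ W p ^ 4 * (4 * f p ^ 3 * W p -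
      (pdu f p ^ 2 + pdv f p ^ 2 - f p * (pdu (pdu f) p + pdv (pdv f) p))) := by
    rw [u1, v1, u2, v2, hap] at hsub
    linear_combination hsub + 2 * f p ^ 2 * W p ^ 2 * hgauss
  have hfirst := nonneg_of_mul_nonneg_right hmain (by positivity)
  refine ⟨by linarith, ?_⟩
  rcases hfp.lt_or_eq with hpos | hzero
  · have : 0 ≤ f p * (pdu (pdu f) p + pdv (pdv f) p + 4 * f p ^ 2 * W p) := by
      nlinarith [sq_nonneg (pdu f p), sq_nonneg (pdv f p)]
    linarith [nonneg_of_mul_nonneg_right this hpos]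
  · obtain ⟨gu, gv⟩ := hgrad (by rw [hap, ← hzero, zero_mul])
    have fu : pdu f p = 0 := by
      rw [u1, ← hzero] at gu
      simpa [hWp.ne'] using gu
    have fv : pdv f p = 0 := by
      rw [v1, ← hzero] at gv
      simpa [hWp.ne'] using gv
    rw [u2, v2, ← hzero, fu, fv] at hlap
    have : 0 ≤ W p ^ 2 * (pdu (pdu f) p + pdv (pdv f) p) := by linarith
    rw [← hzero]
    linarith [nonneg_of_mul_nonneg_right this (by positivity)]

section MinimalImmersion

theorem inner_eq_of_orthogonal_frame {G ι : Type*} [NormedAddCommGroup G]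
    [InnerProductSpace ℝ G] [FiniteDimensional ℝ G] [Fintype ι] [DecidableEq ι] {a b : G}
    {n : ι → G} {w : ℝ} (hdim : Module.finrank ℝ G = Fintype.card ι + 2) (hw : 0 < w)
    (haa : ⟪a, a⟫ = w) (hbb : ⟪b, b⟫ = w) (hab : ⟪a, b⟫ = 0) (han : ∀ i, ⟪a, n i⟫ = 0)
    (hbn : ∀ i, ⟪b, n i⟫ = 0) (hnn : ∀ i j, ⟪n i, n j⟫ = if i = j then 1 else 0) (x y : G) :
    ⟪x, y⟫ = (⟪x, a⟫ * ⟪y, a⟫ + ⟪x, b⟫ * ⟪y, b⟫) / w + ∑ i, ⟪x, n i⟫ * ⟪y, n i⟫ := by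
  have hs : √w * √w = w := Real.mul_self_sqrt hw.le
  set c : ℝ := (√w)⁻¹ with hc
  have hcw : c * (c * w) = 1 := by
    rw [hc, ← hs]
    simp only [Real.sqrt_mul_self (Real.sqrt_nonneg w)]
    field_simp
  have hcc : c * c = w⁻¹ := by
    field_simp
    linarith
  set v : Fin 2 ⊕ ι → G := Sum.elim ![c • a, c • b] n with hv
  have hba : ⟪b, a⟫ = 0 := by rw [real_inner_comm, hab]
  have hna i : ⟪n i, a⟫ = 0 := by rw [real_inner_comm, han]
  have hnb i : ⟪n i, b⟫ = 0 := by rw [real_inner_comm, hbn]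
  have hon : Orthonormal ℝ v := by
    rw [orthonormal_iff_ite]
    rintro (i | i) (j | j)
    · fin_cases i <;> fin_cases j <;>
        simp [hv, real_inner_smul_left, real_inner_smul_right, haa, hbb, hab, hba, hcw,
          -inner_self_eq_norm_sq_to_K]
    · fin_cases i <;> simp [hv, real_inner_smul_left, han, hbn]
    · fin_cases j <;> simp [hv, real_inner_smul_right, hna, hnb]
    · simp [hv, hnn]
  have hspan : ⊤ ≤ Submodule.span ℝ (Set.range v) :=
    (hon.linearIndependent.span_eq_top_of_card_eq_finrank' (by simp [hdim, add_comm])).ge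
  have h := (OrthonormalBasis.mk hon hspan).sum_inner_mul_inner x y
  rw [← h, Fintype.sum_sum_type, Fin.sum_univ_two]
  simp only [OrthonormalBasis.coe_mk, hv, Sum.elim_inl, Sum.elim_inr, Matrix.cons_val_zero,
    Matrix.cons_val_one, real_inner_smul_left, real_inner_smul_right]
  congr 1
  · rw [real_inner_comm y a, real_inner_comm y b, div_eq_inv_mul, ← hcc]
    ring
  · exact Finset.sum_congr rfl fun i _ => by rw [real_inner_comm y]

theorem inner_fderiv_add_inner_fderiv {E G : Type*} [NormedAddCommGroup E] [NormedSpace ℝ E]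
    [NormedAddCommGroup G] [InnerProductSpace ℝ G] {U : Set E} {p : E} {f g : E → G} {c : E → ℝ}
    (hU : IsOpen U) (hp : p ∈ U) (hf : DifferentiableAt ℝ f p) (hg : DifferentiableAt ℝ g p)
    (h : ∀ q ∈ U, ⟪f q, g q⟫ = c q) (e : E) :
    ⟪f p, fderiv ℝ g p e⟫ + ⟪fderiv ℝ f p e, g p⟫ = fderiv ℝ c p e := by
  rw [← fderiv_inner_apply ℝ hf hg, Set.EqOn.fderiv_eq hU (fun q hq => h q hq) hp]

theorem inner_fderiv_add_inner_fderiv_of_const {E G : Type*} [NormedAddCommGroup E]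
    [NormedSpace ℝ E] [NormedAddCommGroup G] [InnerProductSpace ℝ G] {U : Set E} {p : E}
    {f g : E → G} {c : ℝ} (hU : IsOpen U) (hp : p ∈ U) (hf : DifferentiableAt ℝ f p)
    (hg : DifferentiableAt ℝ g p) (h : ∀ q ∈ U, ⟪f q, g q⟫ = c) (e : E) :
    ⟪f p, fderiv ℝ g p e⟫ + ⟪fderiv ℝ f p e, g p⟫ = 0 := by
  simpa using inner_fderiv_add_inner_fderiv hU hp hf hg h e

variable {d : ℕ} {ι : Type*} [Fintype ι] [DecidableEq ι] {U : Set (ℝ × ℝ)}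
  {X : ℝ × ℝ → EuclideanSpace ℝ (Fin d)} {W : ℝ × ℝ → ℝ}

theorem conformal_inner_second_derivatives (hU : IsOpen U) (hX : ContDiffOn ℝ 2 X U)
    (hconfu : ∀ p ∈ U, ⟪pdu X p, pdu X p⟫ = W p) (hconfv : ∀ p ∈ U, ⟪pdv X p, pdv X p⟫ = W p)
    (hconfuv : ∀ p ∈ U, ⟪pdu X p, pdv X p⟫ = 0) {p : ℝ × ℝ} (hp : p ∈ U) :
    (⟪pdu (pdu X) p, pdu X p⟫ = pdu W p / 2 ∧ ⟪pdu (pdu X) p, pdv X p⟫ = -(pdv W p / 2)) ∧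
    (⟪pdv (pdu X) p, pdu X p⟫ = pdv W p / 2 ∧ ⟪pdv (pdu X) p, pdv X p⟫ = pdu W p / 2) ∧
    ⟪pdv (pdv X) p, pdu X p⟫ = -(pdu W p / 2) ∧ ⟪pdv (pdv X) p, pdv X p⟫ = pdv W p / 2 := by
  have du : DifferentiableAt ℝ (pdu X) p := ContDiffOn.differentiableAt_of_isOpen (n := 0) hU
    (ContDiffOn.fderiv_apply_const (n := 1) hU hX (1, 0)) hp
  have dv : DifferentiableAt ℝ (pdv X) p := ContDiffOn.differentiableAt_of_isOpen (n := 0) hU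
    (ContDiffOn.fderiv_apply_const (n := 1) hU hX (0, 1)) hp
  have hsym : pdu (pdv X) p = pdv (pdu X) p := fderiv_fderiv_apply_comm hU hX hp _ _
  have uu_u : ⟪pdu X p, pdu (pdu X) p⟫ + ⟪pdu (pdu X) p, pdu X p⟫ = pdu W p :=
    inner_fderiv_add_inner_fderiv hU hp du du hconfu (1, 0)
  have uu_v : ⟪pdu X p, pdv (pdu X) p⟫ + ⟪pdv (pdu X) p, pdu X p⟫ = pdv W p :=
    inner_fderiv_add_inner_fderiv hU hp du du hconfu (0, 1)
  have vv_u : ⟪pdv X p, pdu (pdv X) p⟫ + ⟪pdu (pdv X) p, pdv X p⟫ = pdu W p :=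
    inner_fderiv_add_inner_fderiv hU hp dv dv hconfv (1, 0)
  have vv_v : ⟪pdv X p, pdv (pdv X) p⟫ + ⟪pdv (pdv X) p, pdv X p⟫ = pdv W p :=
    inner_fderiv_add_inner_fderiv hU hp dv dv hconfv (0, 1)
  have uv_u : ⟪pdu X p, pdu (pdv X) p⟫ + ⟪pdu (pdu X) p, pdv X p⟫ = 0 :=
      inner_fderiv_add_inner_fderiv_of_const hU hp du dv hconfuv (1, 0)
  have uv_v : ⟪pdu X p, pdv (pdv X) p⟫ + ⟪pdv (pdu X) p, pdv X p⟫ = 0 :=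
      inner_fderiv_add_inner_fderiv_of_const hU hp du dv hconfuv (0, 1)
  rw [hsym] at vv_u uv_u
  rw [real_inner_comm] at uu_u uu_v vv_u vv_v uv_u uv_v
  refine ⟨⟨?_, ?_⟩, ⟨?_, ?_⟩, ?_, ?_⟩ <;> linarith

/-- A conformally parametrized minimal immersion is harmonic. -/
theorem conformal_minimal_harmonic {N : ι → ℝ × ℝ → EuclideanSpace ℝ (Fin d)}
    (hd : d = Fintype.card ι + 2) (hU : IsOpen U) (hX : ContDiffOn ℝ 2 X U)
    (hWpos : ∀ p ∈ U, 0 < W p)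
    (hconfu : ∀ p ∈ U, ⟪pdu X p, pdu X p⟫ = W p) (hconfv : ∀ p ∈ U, ⟪pdv X p, pdv X p⟫ = W p)
    (hconfuv : ∀ p ∈ U, ⟪pdu X p, pdv X p⟫ = 0)
    (hNXu : ∀ σ, ∀ p ∈ U, ⟪pdu X p, N σ p⟫ = 0) (hNXv : ∀ σ, ∀ p ∈ U, ⟪pdv X p, N σ p⟫ = 0)
    (hNN : ∀ σ ω, ∀ p ∈ U, ⟪N σ p, N ω p⟫ = if σ = ω then 1 else 0)
    (hmin : ∀ σ, ∀ p ∈ U, L11 X (N σ) p + L22 X (N σ) p = 0) {p : ℝ × ℝ} (hp : p ∈ U) :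
    pdu (pdu X) p = -pdv (pdv X) p := by
  obtain ⟨⟨h1, h2⟩, -, h3, h4⟩ :=
    conformal_inner_second_derivatives hU hX hconfu hconfv hconfuv hp
  have hmin' σ : ⟪pdu (pdu X) p, N σ p⟫ + ⟪pdv (pdv X) p, N σ p⟫ = 0 := hmin σ p hp
  have h := inner_eq_of_orthogonal_frame (by simpa using hd) (hWpos p hp) (hconfu p hp)
    (hconfv p hp) (hconfuv p hp) (fun σ => hNXu σ p hp) (fun σ => hNXv σ p hp)
    (fun σ ω => hNN σ ω p hp) (pdu (pdu X) p + pdv (pdv X) p) (pdu (pdu X) p + pdv (pdv X) p)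
  simp only [inner_add_left _ _ (N _ p), inner_add_left _ _ (pdu X p),
    inner_add_left _ _ (pdv X p), hmin', h1, h2, h3, h4] at h
  rw [← add_eq_zero_iff_eq_neg, ← inner_self_eq_zero (𝕜 := ℝ), h]
  simp

/-- The Gauss equation `Δ log W = 2 W⁻² ∑ |L_σ|²` of a conformally parametrized minimal
immersion. -/
theorem conformal_minimal_gauss {N : ι → ℝ × ℝ → EuclideanSpace ℝ (Fin d)}
    (hd : d = Fintype.card ι + 2) (hU : IsOpen U) (hX : ContDiffOn ℝ 3 X U)
    (hWpos : ∀ p ∈ U, 0 < W p)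
    (hconfu : ∀ p ∈ U, ⟪pdu X p, pdu X p⟫ = W p) (hconfv : ∀ p ∈ U, ⟪pdv X p, pdv X p⟫ = W p)
    (hconfuv : ∀ p ∈ U, ⟪pdu X p, pdv X p⟫ = 0)
    (hNXu : ∀ σ, ∀ p ∈ U, ⟪pdu X p, N σ p⟫ = 0) (hNXv : ∀ σ, ∀ p ∈ U, ⟪pdv X p, N σ p⟫ = 0)
    (hNN : ∀ σ ω, ∀ p ∈ U, ⟪N σ p, N ω p⟫ = if σ = ω then 1 else 0)
    (hmin : ∀ σ, ∀ p ∈ U, L11 X (N σ) p + L22 X (N σ) p = 0) {p : ℝ × ℝ} (hp : p ∈ U) :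
    W p * (pdu (pdu W) p + pdv (pdv W) p) - (pdu W p ^ 2 + pdv W p ^ 2) =
      2 * W p * ∑ σ, (L11 X (N σ) p ^ 2 + L12 X (N σ) p ^ 2) := by
  have hX2 : ContDiffOn ℝ 2 X U := hX.of_le (by norm_num)
  have hXu : ContDiffOn ℝ 2 (pdu X) U := ContDiffOn.fderiv_apply_const (n := 2) hU hX (1, 0)
  have hXv : ContDiffOn ℝ 2 (pdv X) U := ContDiffOn.fderiv_apply_const (n := 2) hU hX (0, 1)
  have hWU : Set.EqOn W (fun q => ⟪pdu X q, pdu X q⟫) U := fun q hq => (hconfu q hq).symm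
  have hDD (e : ℝ × ℝ) : fderiv ℝ (fun q => fderiv ℝ W q e) p e =
      2 * (⟪pdu X p, fderiv ℝ (fun q => fderiv ℝ (pdu X) q e) p e⟫ +
        ⟪fderiv ℝ (pdu X) p e, fderiv ℝ (pdu X) p e⟫) := by
    have hEq : Set.EqOn (fun q => fderiv ℝ W q e)
        (fun q => fderiv ℝ (fun r => ⟪pdu X r, pdu X r⟫) q e) U :=
      fun q hq => by simp only [hWU.fderiv_eq hU hq]
    rw [hEq.fderiv_eq hU hp, fderiv_fderiv_inner_self_apply hU hXu hp]
  have e1 : pdu (pdu W) p = 2 * (⟪pdu X p, pdu (pdu (pdu X)) p⟫ +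
    ⟪pdu (pdu X) p, pdu (pdu X) p⟫) := hDD (1, 0)
  have e2 : pdv (pdv W) p = 2 * (⟪pdu X p, pdv (pdv (pdu X)) p⟫ +
    ⟪pdv (pdu X) p, pdv (pdu X) p⟫) := hDD (0, 1)
  have hharm : pdu (pdu (pdu X)) p = -pdv (pdv (pdu X)) p := by
    have s1 : Set.EqOn (pdu (pdu X)) (fun q => -pdv (pdv X) q) U := fun q hq =>
      conformal_minimal_harmonic hd hU hX2 hWpos hconfu hconfv hconfuv hNXu hNXv hNN hmin hq
    have s2 : Set.EqOn (pdv (pdu X)) (pdu (pdv X)) U := fun q hq =>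
      fderiv_fderiv_apply_comm hU hX2 hq _ _
    have s3 : pdv (pdu (pdv X)) p = pdu (pdv (pdv X)) p :=
      fderiv_fderiv_apply_comm hU hXv hp _ _
    have s4 : pdv (pdv (pdu X)) p = pdv (pdu (pdv X)) p := by
      change fderiv ℝ (pdv (pdu X)) p _ = fderiv ℝ (pdu (pdv X)) p _
      rw [s2.fderiv_eq hU hp]
    rw [s4, s3]
    change fderiv ℝ (pdu (pdu X)) p _ = -fderiv ℝ (pdv (pdv X)) p _
    rw [s1.fderiv_eq hU hp]
    simp
  obtain ⟨⟨h1, h2⟩, ⟨h3, h4⟩, -⟩ :=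
    conformal_inner_second_derivatives hU hX2 hconfu hconfv hconfuv hp
  have hframe := fun x => inner_eq_of_orthogonal_frame (by simpa using hd) (hWpos p hp)
    (hconfu p hp) (hconfv p hp) (hconfuv p hp) (fun σ => hNXu σ p hp) (fun σ => hNXv σ p hp)
    (fun σ ω => hNN σ ω p hp) x x
  have n1 : ⟪pdu (pdu X) p, pdu (pdu X) p⟫ =
      (pdu W p ^ 2 + pdv W p ^ 2) / (4 * W p) + ∑ σ, L11 X (N σ) p ^ 2 := by
    rw [hframe, h1, h2]
    congr 1
    · have := hWpos p hp
      field_simp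
      ring
    · exact Finset.sum_congr rfl fun σ _ => (sq _).symm
  have n2 : ⟪pdv (pdu X) p, pdv (pdu X) p⟫ =
      (pdu W p ^ 2 + pdv W p ^ 2) / (4 * W p) + ∑ σ, L12 X (N σ) p ^ 2 := by
    rw [hframe, h3, h4]
    congr 1
    · have := hWpos p hp
      field_simp
      ring
    · exact Finset.sum_congr rfl fun σ _ => (sq _).symm
  rw [e1, e2, n1, n2, hharm, inner_neg_right, Finset.sum_add_distrib]
  have := hWpos p hp
  field_simp
  ring

/-- The Codazzi equations of a conformally parametrized minimal immersion in a torsion-free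
normal frame are the Cauchy–Riemann equations for `L_{σ,11} - i L_{σ,12}`. -/
theorem conformal_minimal_codazzi {N : ι → ℝ × ℝ → EuclideanSpace ℝ (Fin d)}
    (hd : d = Fintype.card ι + 2) (hU : IsOpen U) (hX : ContDiffOn ℝ 3 X U)
    (hWpos : ∀ p ∈ U, 0 < W p)
    (hconfu : ∀ p ∈ U, ⟪pdu X p, pdu X p⟫ = W p) (hconfv : ∀ p ∈ U, ⟪pdv X p, pdv X p⟫ = W p)
    (hconfuv : ∀ p ∈ U, ⟪pdu X p, pdv X p⟫ = 0) (hN : ∀ σ, ContDiffOn ℝ 1 (N σ) U)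
    (hNXu : ∀ σ, ∀ p ∈ U, ⟪pdu X p, N σ p⟫ = 0) (hNXv : ∀ σ, ∀ p ∈ U, ⟪pdv X p, N σ p⟫ = 0)
    (hNN : ∀ σ ω, ∀ p ∈ U, ⟪N σ p, N ω p⟫ = if σ = ω then 1 else 0)
    (hmin : ∀ σ, ∀ p ∈ U, L11 X (N σ) p + L22 X (N σ) p = 0)
    (htor : ∀ σ ω, σ ≠ ω → ∀ p ∈ U, ⟪pdu (N σ) p, N ω p⟫ = 0 ∧ ⟪pdv (N σ) p, N ω p⟫ = 0)
    (σ : ι) {p : ℝ × ℝ} (hp : p ∈ U) :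
    pdu (L11 X (N σ)) p = -pdv (L12 X (N σ)) p ∧ pdv (L11 X (N σ)) p = pdu (L12 X (N σ)) p := by
  have hX2 : ContDiffOn ℝ 2 X U := hX.of_le (by norm_num)
  have hXu : ContDiffOn ℝ 2 (pdu X) U := ContDiffOn.fderiv_apply_const (n := 2) hU hX (1, 0)
  have hXv : ContDiffOn ℝ 2 (pdv X) U := ContDiffOn.fderiv_apply_const (n := 2) hU hX (0, 1)
  have du := ContDiffOn.differentiableAt_of_isOpen (n := 1) hU hXu hp
  have dv := ContDiffOn.differentiableAt_of_isOpen (n := 1) hU hXv hp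
  have dN := ContDiffOn.differentiableAt_of_isOpen (n := 0) hU (hN σ) hp
  have duu : DifferentiableAt ℝ (pdu (pdu X)) p :=
    ContDiffOn.differentiableAt_of_isOpen (n := 0) hU
      (ContDiffOn.fderiv_apply_const (n := 1) hU hXu (1, 0)) hp
  have duv : DifferentiableAt ℝ (pdv (pdu X)) p :=
    ContDiffOn.differentiableAt_of_isOpen (n := 0) hU
      (ContDiffOn.fderiv_apply_const (n := 1) hU hXu (0, 1)) hp
  have hsymX : Set.EqOn (pdv (pdu X)) (pdu (pdv X)) U := fun q hq =>
    fderiv_fderiv_apply_comm hU hX2 hq _ _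
  have hharm : Set.EqOn (pdu (pdu X)) (fun q => -pdv (pdv X) q) U := fun q hq =>
    conformal_minimal_harmonic hd hU hX2 hWpos hconfu hconfv hconfuv hNXu hNXv hNN hmin hq
  have t1 : pdu (pdv (pdu X)) p = pdv (pdu (pdu X)) p :=
    fderiv_fderiv_apply_comm hU hXu hp _ _
  have t2 : pdu (pdu (pdu X)) p = -pdv (pdv (pdu X)) p := by
    have s3 : pdv (pdu (pdv X)) p = pdu (pdv (pdv X)) p :=
      fderiv_fderiv_apply_comm hU hXv hp _ _
    have s4 : pdv (pdv (pdu X)) p = pdv (pdu (pdv X)) p := by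
      change fderiv ℝ (pdv (pdu X)) p _ = fderiv ℝ (pdu (pdv X)) p _
      rw [hsymX.fderiv_eq hU hp]
    rw [s4, s3]
    change fderiv ℝ (pdu (pdu X)) p _ = -fderiv ℝ (pdv (pdv X)) p _
    rw [hharm.fderiv_eq hU hp]
    simp
  have l11 (e : ℝ × ℝ) := fderiv_inner_apply ℝ duu dN e
  have l12 (e : ℝ × ℝ) := fderiv_inner_apply ℝ duv dN e
  have a1 : pdu (L11 X (N σ)) p =
    ⟪pdu (pdu X) p, pdu (N σ) p⟫ + ⟪pdu (pdu (pdu X)) p, N σ p⟫ := l11 (1, 0)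
  have a2 : pdv (L11 X (N σ)) p =
    ⟪pdu (pdu X) p, pdv (N σ) p⟫ + ⟪pdv (pdu (pdu X)) p, N σ p⟫ := l11 (0, 1)
  have a3 : pdu (L12 X (N σ)) p =
    ⟪pdv (pdu X) p, pdu (N σ) p⟫ + ⟪pdu (pdv (pdu X)) p, N σ p⟫ := l12 (1, 0)
  have a4 : pdv (L12 X (N σ)) p =
    ⟪pdv (pdu X) p, pdv (N σ) p⟫ + ⟪pdv (pdv (pdu X)) p, N σ p⟫ := l12 (0, 1)
  have w1 : ⟪pdu X p, pdu (N σ) p⟫ + ⟪pdu (pdu X) p, N σ p⟫ = 0 :=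
      inner_fderiv_add_inner_fderiv_of_const hU hp du dN (hNXu σ) (1, 0)
  have w2 : ⟪pdu X p, pdv (N σ) p⟫ + ⟪pdv (pdu X) p, N σ p⟫ = 0 :=
      inner_fderiv_add_inner_fderiv_of_const hU hp du dN (hNXu σ) (0, 1)
  have w3 : ⟪pdv X p, pdu (N σ) p⟫ + ⟪pdu (pdv X) p, N σ p⟫ = 0 :=
      inner_fderiv_add_inner_fderiv_of_const hU hp dv dN (hNXv σ) (1, 0)
  have w4 : ⟪pdv X p, pdv (N σ) p⟫ + ⟪pdv (pdv X) p, N σ p⟫ = 0 :=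
      inner_fderiv_add_inner_fderiv_of_const hU hp dv dN (hNXv σ) (0, 1)
  have hharm' : ⟪pdu (pdu X) p, N σ p⟫ = -⟪pdv (pdv X) p, N σ p⟫ := by
    rw [hharm hp, inner_neg_left]
  rw [← hsymX hp] at w3
  have hnormal : ∀ ω, ⟪pdu (N σ) p, N ω p⟫ = 0 ∧ ⟪pdv (N σ) p, N ω p⟫ = 0 := by
    intro ω
    by_cases h : σ = ω
    · subst h
      have c1 : ⟪N σ p, pdu (N σ) p⟫ + ⟪pdu (N σ) p, N σ p⟫ = 0 :=
      inner_fderiv_add_inner_fderiv_of_const hU hp dN dN (hNN σ σ) (1, 0)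
      have c2 : ⟪N σ p, pdv (N σ) p⟫ + ⟪pdv (N σ) p, N σ p⟫ = 0 :=
      inner_fderiv_add_inner_fderiv_of_const hU hp dN dN (hNN σ σ) (0, 1)
      rw [real_inner_comm] at c1 c2
      constructor <;> linarith
    · exact htor σ ω h p hp
  have hframe := inner_eq_of_orthogonal_frame (by simpa using hd) (hWpos p hp)
    (hconfu p hp) (hconfv p hp) (hconfuv p hp) (fun σ => hNXu σ p hp) (fun σ => hNXv σ p hp)
    (fun σ ω => hNN σ ω p hp)
  obtain ⟨⟨h1, h2⟩, ⟨h3, h4⟩, -⟩ :=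
    conformal_inner_second_derivatives hU hX2 hconfu hconfv hconfuv hp
  rw [real_inner_comm] at w1 w2 w3 w4
  rw [a1, a2, a3, a4, t1, t2, inner_neg_left, hframe (pdu (pdu X) p) (pdu (N σ) p),
    hframe (pdu (pdu X) p) (pdv (N σ) p), hframe (pdv (pdu X) p) (pdu (N σ) p),
    hframe (pdv (pdu X) p) (pdv (N σ) p)]
  simp only [hnormal, mul_zero, Finset.sum_const_zero, add_zero, h1, h2, h3, h4,
    eq_neg_of_add_eq_zero_left w1, eq_neg_of_add_eq_zero_left w2,
    eq_neg_of_add_eq_zero_left w3, eq_neg_of_add_eq_zero_left w4, hharm']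
  constructor <;> ring

end MinimalImmersion

/-- Curvature bound `K̂ ≤ 1` for the auxiliary conformal metric
`ĝ_ij = (κ₀ − K) g_ij`.  For the real-valued function `γ = κ₀ − K` one has
`γ_w γ_w̄ = (γ_u² + γ_v²)/4` and `γ_{ww̄} = (Δγ)/4`. -/
theorem curvature_bound_auxiliary_metric
    (m : ℕ)
    (X : ℝ × ℝ → EuclideanSpace ℝ (Fin (m + 3)))
    (hX : ContDiffOn ℝ 3 X Disc)
    (W : ℝ × ℝ → ℝ)
    (hWpos : ∀ p ∈ Disc, 0 < W p)
    (hconfu : ∀ p ∈ Disc, ⟪pdu X p, pdu X p⟫ = W p)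
    (hconfv : ∀ p ∈ Disc, ⟪pdv X p, pdv X p⟫ = W p)
    (hconfuv : ∀ p ∈ Disc, ⟪pdu X p, pdv X p⟫ = 0)
    (N : Fin (m + 1) → ℝ × ℝ → EuclideanSpace ℝ (Fin (m + 3)))
    (hN : ∀ σ, ContDiffOn ℝ 2 (N σ) Disc)
    (hNXu : ∀ σ, ∀ p ∈ Disc, ⟪pdu X p, N σ p⟫ = 0)
    (hNXv : ∀ σ, ∀ p ∈ Disc, ⟪pdv X p, N σ p⟫ = 0)
    (hNN : ∀ σ ω, ∀ p ∈ Disc, ⟪N σ p, N ω p⟫ = if σ = ω then 1 else 0)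
    -- X is minimal: `H_σ ≡ 0` for all `σ`
    (hminimal : ∀ σ, ∀ p ∈ Disc, (L11 X (N σ) p + L22 X (N σ) p) / (2 * W p) = 0)
    -- the orthonormal normal section is torsion-free
    (htorsionfree : ∀ σ ω, ∀ p ∈ Disc, Tor1 N σ ω p = 0 ∧ Tor2 N σ ω p = 0)
    (κ₀ : ℝ) (hκ₀ : 0 < κ₀)
    (hKnonpos : ∀ p ∈ Disc, Ktot X W N p ≤ 0)
    (hγpos : ∀ p ∈ Disc, 0 < κ₀ - Ktot X W N p)
    : (∀ p ∈ Metric.ball (0 : ℝ × ℝ) 1,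
        ((pdu (fun q => κ₀ - Ktot X W N q) p) ^ 2 + (pdv (fun q => κ₀ - Ktot X W N q) p) ^ 2) / 4
            - (κ₀ - Ktot X W N p) *
              ((pdu (pdu (fun q => κ₀ - Ktot X W N q)) p +
                pdv (pdv (fun q => κ₀ - Ktot X W N q)) p) / 4)
          ≤ (κ₀ - Ktot X W N p) ^ 3 / 2 * W p - (κ₀ - Ktot X W N p) ^ 2 / 2 * Ktot X W N p * W p) ∧
      (∀ Khat : ℝ × ℝ → ℝ,
        (∀ p ∈ Metric.ball (0 : ℝ × ℝ) 1,
          (κ₀ - Ktot X W N p) ^ 3 * Khat p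
            = (κ₀ - Ktot X W N p) ^ 2 * Ktot X W N p +
              (2 / W p) *
                (((pdu (fun q => κ₀ - Ktot X W N q) p) ^ 2 +
                    (pdv (fun q => κ₀ - Ktot X W N q) p) ^ 2) / 4
                  - (κ₀ - Ktot X W N p) *
                    ((pdu (pdu (fun q => κ₀ - Ktot X W N q)) p +
                      pdv (pdv (fun q => κ₀ - Ktot X W N q)) p) / 4))) →
        ∀ p ∈ Metric.ball (0 : ℝ × ℝ) 1, Khat p ≤ 1) := by
  have hU : IsOpen (Metric.ball (0 : ℝ × ℝ) 1) := Metric.isOpen_ball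
  have hsub : Metric.ball (0 : ℝ × ℝ) 1 ⊆ Disc := Metric.ball_subset_closedBall
  set U := Metric.ball (0 : ℝ × ℝ) 1
  have hXU : ContDiffOn ℝ 3 X U := hX.mono hsub
  have hmin : ∀ σ, ∀ p ∈ U, L11 X (N σ) p + L22 X (N σ) p = 0 := fun σ p hp => by
    have := hWpos p (hsub hp)
    simpa [this.ne'] using hminimal σ p (hsub hp)
  have htor : ∀ σ ω, σ ≠ ω → ∀ p ∈ U, ⟪pdu (N σ) p, N ω p⟫ = 0 ∧ ⟪pdv (N σ) p, N ω p⟫ = 0 :=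
    fun σ ω h p hp => by simpa [Tor1, Tor2, h] using htorsionfree σ ω p (hsub hp)
  have hWU p (hp : p ∈ U) := hWpos p (hsub hp)
  have hcu p (hp : p ∈ U) := hconfu p (hsub hp)
  have hcv p (hp : p ∈ U) := hconfv p (hsub hp)
  have hcuv p (hp : p ∈ U) := hconfuv p (hsub hp)
  have hnu σ p (hp : p ∈ U) := hNXu σ p (hsub hp)
  have hnv σ p (hp : p ∈ U) := hNXv σ p (hsub hp)
  have hnn σ ω p (hp : p ∈ U) := hNN σ ω p (hsub hp)
  have hN1 σ : ContDiffOn ℝ 1 (N σ) U := ((hN σ).mono hsub).of_le (by norm_num)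
  have hdim : m + 3 = Fintype.card (Fin (m + 1)) + 2 := by simp
  have hgauss {p} (hp : p ∈ U) :=
    conformal_minimal_gauss hdim hU hXU hWU hcu hcv hcuv hnu hnv hnn hmin hp
  have hcod σ {p} (hp : p ∈ U) :=
    conformal_minimal_codazzi hdim hU hXU hWU hcu hcv hcuv hN1 hnu hnv hnn hmin htor σ hp
  have hXu : ContDiffOn ℝ 2 (pdu X) U := ContDiffOn.fderiv_apply_const (n := 2) hU hXU (1, 0)
  have hWC : ContDiffOn ℝ 2 W U := (hXu.inner ℝ hXu).congr fun p hp => (hcu p hp).symm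
  have hL11 σ : ContDiffOn ℝ 1 (L11 X (N σ)) U :=
    (ContDiffOn.fderiv_apply_const (n := 1) hU hXu (1, 0)).inner ℝ (hN1 σ)
  have hL12 σ : ContDiffOn ℝ 1 (L12 X (N σ)) U :=
    (ContDiffOn.fderiv_apply_const (n := 1) hU hXu (0, 1)).inner ℝ (hN1 σ)
  set a : ℝ × ℝ → ℝ := fun p => ∑ σ, (L11 X (N σ) p ^ 2 + L12 X (N σ) p ^ 2) with ha
  obtain ⟨haC, hasub⟩ := log_subharmonic_sum_sq_of_cauchyRiemann hU hL11 hL12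
    (fun σ p hp => (hcod σ hp).1) (fun σ p hp => (hcod σ hp).2) (a := a) fun p _ => rfl
  have hK : ∀ p ∈ U, -Ktot X W N p = a p / (W p * W p) := fun p hp => by
    simp only [Ktot, ha, Finset.sum_div, ← Finset.sum_neg_distrib]
    refine Finset.sum_congr rfl fun σ _ => ?_
    rw [eq_neg_of_add_eq_zero_right (hmin σ p hp)]
    ring
  have hfC : ContDiffOn ℝ 2 (fun p => -Ktot X W N p) U :=
    (haC.div (hWC.mul hWC) fun p hp => (mul_pos (hWU p hp) (hWU p hp)).ne').congr hK
  have haf : Set.EqOn a (fun p => -Ktot X W N p * (W p * W p)) U := fun p hp => by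
    have := hWU p hp
    simp only [hK p hp]
    field_simp
  have hγ (e p : ℝ × ℝ) : fderiv ℝ (fun q => κ₀ - Ktot X W N q) p e =
      fderiv ℝ (fun q => -Ktot X W N q) p e := by
    simp only [sub_eq_add_neg, fderiv_const_add]
  have hγu : pdu (fun q => κ₀ - Ktot X W N q) = pdu (fun q => -Ktot X W N q) :=
    funext (hγ (1, 0))
  have hγv : pdv (fun q => κ₀ - Ktot X W N q) = pdv (fun q => -Ktot X W N q) :=
    funext (hγ (0, 1))
  rw [hγu, hγv]
  have hmain : ∀ p ∈ U, (pdu (fun q => -Ktot X W N q) p ^ 2 +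
        pdv (fun q => -Ktot X W N q) p ^ 2) / 4 - (κ₀ - Ktot X W N p) *
        ((pdu (pdu (fun q => -Ktot X W N q)) p + pdv (pdv (fun q => -Ktot X W N q)) p) / 4) ≤
      (κ₀ - Ktot X W N p) ^ 3 / 2 * W p - (κ₀ - Ktot X W N p) ^ 2 / 2 * Ktot X W N p * W p := by
    intro p hp
    have hW := hWU p hp
    have hk := hKnonpos p (hsub hp)
    obtain ⟨b1, b2, b3⟩ := hasub p hp
    have hg : W p * (pdu (pdu W) p + pdv (pdv W) p) - (pdu W p ^ 2 + pdv W p ^ 2) =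
        2 * -Ktot X W N p * W p ^ 3 := by
      rw [hgauss hp]
      change 2 * W p * a p = _
      rw [haf hp]
      ring
    obtain ⟨c1, c2⟩ := laplacian_quotient_bounds hU hp hfC hWC hW (neg_nonneg.2 hk) haf hg
      b1 b2 b3
    have c3 := mul_le_mul_of_nonneg_left c2 hκ₀.le
    have c4 : 0 ≤ W p * ((κ₀ - Ktot X W N p) * (κ₀ * (κ₀ - 3 * Ktot X W N p))) :=
      mul_nonneg hW.le (mul_nonneg (by linarith) (mul_nonneg hκ₀.le (by linarith)))
    linear_combination c1 / 4 + c3 / 4 + c4 / 2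
  refine ⟨hmain, fun Khat hKhat p hp => ?_⟩
  have hγ3 : 0 < (κ₀ - Ktot X W N p) ^ 3 := pow_pos (hγpos p (hsub hp)) 3
  have hW := hWU p hp
  refine le_of_mul_le_mul_left ?_ hγ3
  rw [hKhat p hp]
  have h := mul_le_mul_of_nonneg_left (hmain p hp) (by positivity : 0 ≤ 2 / W p)
  refine (add_le_add_right h _).trans_eq ?_
  field_simp
  ring
end
end
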